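/- arXiv:1911.10936 — 2 statements merged into one kernel-verified Lean document; each statement's English description precedes it below -/
import Mathlib

section
/- For every t ∈ [0,T], the map x ↦ u^T(t,x) is continuous on ℝ⁴. -/
open MeasureTheory Finset

noncomputable section

/-- The 2π-periodic square wave ψ(r) = sign(sin r). -/
def psi (r : ℝ) : ℝ := Real.sign (Real.sin r)

/-- The vectors α_k ∈ ℝ⁴, α_{k,j} = 3/√2 if k = j and −1/√2 otherwise. -/
def alph : Fin 4 → Fin 4 → ℝ := fun k j => if k = j then 3 / Real.sqrt 2 else -(1 / Real.sqrt 2)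

/-- The vector θ = (1/√2)(1,1,−1,−1) ∈ ℝ⁴. -/
def theta : Fin 4 → ℝ :=
  ![1 / Real.sqrt 2, 1 / Real.sqrt 2, -(1 / Real.sqrt 2), -(1 / Real.sqrt 2)]

/-- Euclidean dot product on ℝ⁴. -/
def dot (a b : Fin 4 → ℝ) : ℝ := ∑ j, a j * b j

/-- The auxiliary function Λ(r,x). -/
def Lam (r : ℝ) (x : Fin 4 → ℝ) : ℝ :=
  psi (r * dot theta x + Real.pi / 2) * (∑ k, Real.cos (r * dot (alph k) x)) - 4
    - psi (r * dot theta x) * (∑ k, Real.sin (r * dot (alph k) x))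

/-- x^o : the increasing rearrangement of the coordinates of x. -/
def sortv (x : Fin 4 → ℝ) : Fin 4 → ℝ := fun i => x (Tuple.sort x i)

/-- The function u^T(t,x). -/
def u (T t : ℝ) (x : Fin 4 → ℝ) : ℝ :=
  -(1 / (16 * Real.sqrt 2)) *
      (∫ r : ℝ, Real.exp (-(T - t) * r ^ 2) * Lam r (sortv x) / r ^ 2)
    + (1 / 4) * ∑ i, x i + (1 / 2) * Real.sqrt ((T - t) * Real.pi / 2)

/-- Partial derivative in the i-th coordinate. -/
def pd (i : Fin 4) (f : (Fin 4 → ℝ) → ℝ) (x : Fin 4 → ℝ) : ℝ :=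
  deriv (fun s => f (Function.update x i s)) (x i)

lemma sortv_continuous : Continuous sortv := by
  have hc : ∀ σ : Equiv.Perm (Fin 4), Continuous (fun x : Fin 4 → ℝ => x ∘ σ) := fun σ => by
    refine continuous_pi fun i => ?_
    exact continuous_apply (σ i)
  refine LocallyFinite.continuous
    (f := fun σ : Equiv.Perm (Fin 4) => {x : Fin 4 → ℝ | Monotone (x ∘ σ)})
    (locallyFinite_of_finite _) ?_ ?_ ?_
  · ext x
    simp only [Set.mem_iUnion, Set.mem_ofPred_eq, Set.mem_univ, iff_true]
    exact ⟨Tuple.sort x, Tuple.monotone_sort x⟩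
  · intro σ
    have : {x : Fin 4 → ℝ | Monotone (x ∘ σ)} =
        ⋂ i, ⋂ j, ⋂ (_ : i ≤ j), {x : Fin 4 → ℝ | x (σ i) ≤ x (σ j)} := by
      ext x
      simp [Monotone]
    rw [this]
    exact isClosed_iInter fun i => isClosed_iInter fun j => isClosed_iInter fun _ =>
      isClosed_le (continuous_apply _) (continuous_apply _)
  · intro σ
    refine (hc σ).continuousOn.congr fun x hx => ?_
    exact ((Tuple.comp_sort_eq_comp_iff_monotone (f := x) (σ := σ)).2 hx).symm

lemma sortv_mono (x : Fin 4 → ℝ) : Monotone (sortv x) := Tuple.monotone_sort x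

lemma dot_cont (a : Fin 4 → ℝ) : Continuous (dot a) := by
  unfold dot; fun_prop

lemma psi_abs (r : ℝ) : |psi r| ≤ 1 := by
  unfold psi
  rcases Real.sign_apply_eq (Real.sin r) with h | h | h <;> rw [h] <;> norm_num

lemma psi_contAt (r : ℝ) (h : Real.sin r ≠ 0) : ContinuousAt psi r := by
  rcases lt_or_gt_of_ne h with h | h
  · have : ∀ᶠ s in nhds r, Real.sin s < 0 :=
      Real.continuous_sin.continuousAt.eventually (gt_mem_nhds h)
    refine (continuousAt_const (y := (-1 : ℝ))).congr ?_
    filter_upwards [this] with s hs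
    simp [psi, Real.sign_of_neg hs]
  · have : ∀ᶠ s in nhds r, 0 < Real.sin s :=
      Real.continuous_sin.continuousAt.eventually (lt_mem_nhds h)
    refine (continuousAt_const (y := (1 : ℝ))).congr ?_
    filter_upwards [this] with s hs
    simp [psi, Real.sign_of_pos hs]

lemma psi_meas : Measurable psi := by
  unfold psi
  have : Measurable Real.sign := by
    unfold Real.sign
    refine Measurable.ite measurableSet_Iio measurable_const ?_
    exact Measurable.ite measurableSet_Ioi measurable_const measurable_const
  exact this.comp Real.measurable_sin

lemma Lam_meas (y : Fin 4 → ℝ) : Measurable (fun r => Lam r y) := by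
  unfold Lam
  have h1 : Measurable fun r : ℝ => psi (r * dot theta y + Real.pi / 2) :=
    psi_meas.comp (by fun_prop)
  have h2 : Measurable fun r : ℝ => psi (r * dot theta y) :=
    psi_meas.comp (by fun_prop)
  fun_prop

lemma sum_abs_le (f : Fin 4 → ℝ) (c : ℝ) (h : ∀ k, |f k| ≤ c) : |∑ k, f k| ≤ 4 * c := by
  refine (Finset.abs_sum_le_sum_abs _ _).trans ?_
  refine (Finset.sum_le_sum fun k _ => h k).trans ?_
  simp

lemma mul_abs_le (a b c : ℝ) (ha : |a| ≤ 1) (hb : |b| ≤ c) : |a * b| ≤ c := by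
  rw [abs_mul]
  nlinarith [abs_nonneg a, abs_nonneg b]

lemma Lam_le (r : ℝ) (y : Fin 4 → ℝ) : |Lam r y| ≤ 12 := by
  unfold Lam
  have h1 := mul_abs_le _ _ _ (psi_abs (r * dot theta y + Real.pi / 2))
    (sum_abs_le (fun k => Real.cos (r * dot (alph k) y)) 1 fun k => Real.abs_cos_le_one _)
  have h2 := mul_abs_le _ _ _ (psi_abs (r * dot theta y))
    (sum_abs_le (fun k => Real.sin (r * dot (alph k) y)) 1 fun k => Real.abs_sin_le_one _)
  rw [abs_le] at *
  constructor <;> linarith [h1.1, h1.2, h2.1, h2.2]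

lemma sum_alph (y : Fin 4 → ℝ) : ∑ k, dot (alph k) y = 0 := by
  simp [dot, alph, Fin.sum_univ_four]
  ring

lemma sin_sub (a : ℝ) (h : |a| ≤ 1) : |Real.sin a - a| ≤ a ^ 2 := by
  have h1 := Real.sin_bound h
  have h2 : |a| ^ 5 ≤ a ^ 2 := by
    rw [← sq_abs a]; exact pow_le_pow_of_le_one (abs_nonneg a) h (by norm_num)
  have h3 : |a ^ 3| ≤ a ^ 2 := by
    rw [← sq_abs a, abs_pow]; exact pow_le_pow_of_le_one (abs_nonneg a) h (by norm_num)
  rw [abs_le] at *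
  constructor <;> nlinarith [h1.1, h1.2, h3.1, h3.2, sq_nonneg a]

lemma cos_sub (a : ℝ) : |Real.cos a - 1| ≤ a ^ 2 := by
  have h1 := Real.one_sub_sq_div_two_le_cos (x := a)
  have h2 := Real.cos_le_one a
  rw [abs_le]
  constructor <;> nlinarith [sq_nonneg a]

lemma Lam_le' (r M : ℝ) (hM : 1 ≤ M) (y : Fin 4 → ℝ) (hth : |dot theta y| ≤ M)
    (hal : ∀ k, |dot (alph k) y| ≤ M) : |Lam r y| ≤ 12 * (M ^ 2 * r ^ 2) := by
  by_cases hr : |r| * M ≤ 1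
  · have key : ∀ a, |a| ≤ M → |r * a| ≤ 1 ∧ (r * a) ^ 2 ≤ M ^ 2 * r ^ 2 := by
      intro a ha
      constructor
      · rw [abs_mul]
        exact (mul_le_mul_of_nonneg_left ha (abs_nonneg r)).trans hr
      · have : a ^ 2 ≤ M ^ 2 := by rw [← sq_abs a]; gcongr
        rw [mul_pow, mul_comm]
        gcongr
    have hp : psi (r * dot theta y + Real.pi / 2) = 1 := by
      unfold psi
      rw [Real.sin_add_pi_div_two]
      apply Real.sign_of_pos
      have := abs_le.1 (key _ hth).1
      apply Real.cos_pos_of_mem_Ioo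
      constructor <;> linarith [this.1, this.2, Real.pi_gt_three]
    have h1 := sum_abs_le (fun k => Real.cos (r * dot (alph k) y) - 1) (M ^ 2 * r ^ 2)
      fun k => (cos_sub _).trans (key _ (hal k)).2
    have h2 := mul_abs_le _ _ _ (psi_abs (r * dot theta y))
      (sum_abs_le (fun k => Real.sin (r * dot (alph k) y) - r * dot (alph k) y) (M ^ 2 * r ^ 2)
      fun k => (sin_sub _ (key _ (hal k)).1).trans (key _ (hal k)).2)
    rw [Finset.sum_sub_distrib, ← Finset.mul_sum, sum_alph] at h2
    rw [Finset.sum_sub_distrib] at h1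
    unfold Lam
    rw [hp]
    have h0 : 0 ≤ M ^ 2 * r ^ 2 := by positivity
    simp only [Finset.sum_const, Finset.card_univ, Fintype.card_fin, nsmul_eq_mul, mul_zero,
      sub_zero, mul_one] at h1 h2
    push_cast at h1
    rw [abs_le] at *
    constructor <;> linarith [h1.1, h1.2, h2.1, h2.2]
  · push Not at hr
    refine (Lam_le r y).trans ?_
    have : 1 ≤ (|r| * M) ^ 2 := one_le_pow₀ hr.le
    rw [mul_pow, sq_abs] at this
    linarith

lemma Lam_contAt (y₀ : Fin 4 → ℝ) (h0 : dot theta y₀ = 0 → ∀ k, dot (alph k) y₀ = 0) :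
    ∀ᵐ r : ℝ, ContinuousAt (fun y => Lam r y) y₀ := by
  have hcos : ∀ r : ℝ, Continuous fun y => ∑ k, Real.cos (r * dot (alph k) y) := fun r => by
    have := fun k => dot_cont (alph k)
    fun_prop
  have hsin : ∀ r : ℝ, Continuous fun y => ∑ k, Real.sin (r * dot (alph k) y) := fun r => by
    have := fun k => dot_cont (alph k)
    fun_prop
  have hth := dot_cont theta
  have hA : ∀ r : ℝ, Real.cos (r * dot theta y₀) ≠ 0 →
      ContinuousAt (fun y => psi (r * dot theta y + Real.pi / 2)) y₀ := fun r hr => by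
    refine ContinuousAt.comp (g := psi) (f := fun y => r * dot theta y + Real.pi / 2)
      (psi_contAt _ ?_) (by fun_prop)
    rwa [Real.sin_add_pi_div_two]
  by_cases hz : dot theta y₀ = 0
  · refine Filter.Eventually.of_forall fun r => ?_
    unfold Lam
    refine (((hA r (by simp [hz])).mul (hcos r).continuousAt).sub continuousAt_const).sub ?_
    have hs0 : ∑ k, Real.sin (r * dot (alph k) y₀) = 0 := by simp [h0 hz]
    have ht : Filter.Tendsto (fun y => ∑ k, Real.sin (r * dot (alph k) y)) (nhds y₀) (nhds 0) := by
      have := (hsin r).tendsto y₀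
      rwa [hs0] at this
    unfold ContinuousAt
    beta_reduce
    rw [hs0, mul_zero]
    refine squeeze_zero_norm (a := fun y => |∑ k, Real.sin (r * dot (alph k) y)|) (fun y => ?_) ?_
    · exact mul_abs_le _ _ _ (psi_abs _) le_rfl
    · simpa using ht.abs
  · have hcount : (Set.range fun n : ℤ => n * Real.pi / (2 * dot theta y₀)).Countable :=
      Set.countable_range _
    filter_upwards [hcount.ae_notMem volume] with r hr
    have h2 : Real.sin (2 * (r * dot theta y₀)) ≠ 0 := by
      intro h
      obtain ⟨n, hn⟩ := Real.sin_eq_zero_iff.1 h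
      refine hr ⟨n, ?_⟩
      simp only
      rw [hn]
      field_simp
    rw [Real.sin_two_mul] at h2
    have hs : Real.sin (r * dot theta y₀) ≠ 0 := fun h => h2 (by simp [h])
    have hc : Real.cos (r * dot theta y₀) ≠ 0 := fun h => h2 (by simp [h])
    unfold Lam
    refine (((hA r hc).mul (hcos r).continuousAt).sub continuousAt_const).sub ?_
    refine ContinuousAt.mul ?_ (hsin r).continuousAt
    exact ContinuousAt.comp (g := psi) (f := fun y => r * dot theta y)
      (psi_contAt _ hs) (by fun_prop)

lemma int_contAt (c : ℝ) (hc : 0 ≤ c) (y₀ : Fin 4 → ℝ)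
    (h0 : dot theta y₀ = 0 → ∀ k, dot (alph k) y₀ = 0) :
    ContinuousAt (fun y => ∫ r : ℝ, Real.exp (-c * r ^ 2) * Lam r y / r ^ 2) y₀ := by
  obtain ⟨M, hM1, hMt, hMa⟩ : ∃ M : ℝ, 1 ≤ M ∧ |dot theta y₀| < M ∧
      ∀ k, |dot (alph k) y₀| < M := by
    have hs : ∀ k, |dot (alph k) y₀| ≤ ∑ k, |dot (alph k) y₀| := fun k =>
      Finset.single_le_sum (f := fun k => |dot (alph k) y₀|) (fun _ _ => abs_nonneg _)
        (Finset.mem_univ k)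
    have hn := (abs_nonneg _).trans (hs 0)
    have ht := abs_nonneg (dot theta y₀)
    refine ⟨1 + |dot theta y₀| + ∑ k, |dot (alph k) y₀|, by linarith, by linarith, fun k => ?_⟩
    linarith [hs k]
  have e1 : ∀ᶠ y in nhds y₀, |dot theta y| < M :=
    (dot_cont theta).abs.continuousAt.eventually (gt_mem_nhds hMt)
  have e2 : ∀ᶠ y in nhds y₀, ∀ k, |dot (alph k) y| < M :=
    Filter.eventually_all.2 fun k =>
      (dot_cont (alph k)).abs.continuousAt.eventually (gt_mem_nhds (hMa k))
  refine continuousAt_of_dominated (bound := fun r => 24 * M ^ 2 * (1 + r ^ 2)⁻¹) ?_ ?_ ?_ ?_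
  · refine Filter.Eventually.of_forall fun y => ?_
    have := Lam_meas y
    exact Measurable.aestronglyMeasurable (by fun_prop)
  · filter_upwards [e1, e2] with y hy1 hy2
    refine Filter.Eventually.of_forall fun r => ?_
    have a1 := Lam_le r y
    have a2 := Lam_le' r M hM1 y hy1.le fun k => (hy2 k).le
    rw [Real.norm_eq_abs, abs_div, abs_mul, abs_of_nonneg (Real.exp_pos _).le,
      abs_of_nonneg (sq_nonneg r)]
    have he : Real.exp (-c * r ^ 2) ≤ 1 := by
      rw [Real.exp_le_one_iff]
      nlinarith [mul_nonneg hc (sq_nonneg r)]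
    have a3 : Real.exp (-c * r ^ 2) * |Lam r y| ≤ |Lam r y| := by
      nlinarith [abs_nonneg (Lam r y)]
    by_cases hr : r = 0
    · subst hr
      simp
      positivity
    have hr2 : 0 < r ^ 2 := by positivity
    rw [← div_eq_mul_inv, div_le_div_iff₀ hr2 (by positivity)]
    have hM2 : 1 ≤ M ^ 2 := one_le_pow₀ hM1
    calc Real.exp (-c * r ^ 2) * |Lam r y| * (1 + r ^ 2) ≤ |Lam r y| * (1 + r ^ 2) := by gcongr
      _ = |Lam r y| + |Lam r y| * r ^ 2 := by ring
      _ ≤ 12 * (M ^ 2 * r ^ 2) + 12 * r ^ 2 := by gcongr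
      _ ≤ 24 * M ^ 2 * r ^ 2 := by nlinarith
  · exact integrable_inv_one_add_sq.const_mul _
  · filter_upwards [Lam_contAt y₀ h0] with r hr
    exact (continuousAt_const.mul hr).div_const _

lemma mono_dot (y : Fin 4 → ℝ) (hy : Monotone y) (h : dot theta y = 0) (k : Fin 4) :
    dot (alph k) y = 0 := by
  have h01 : y 0 ≤ y 1 := hy (by decide)
  have h12 : y 1 ≤ y 2 := hy (by decide)
  have h23 : y 2 ≤ y 3 := hy (by decide)
  have hs : (0 : ℝ) < 1 / Real.sqrt 2 := by positivity
  have h' : 1 / Real.sqrt 2 * (y 0 + y 1 - y 2 - y 3) = 0 := by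
    rw [← h]
    simp [dot, theta, Fin.sum_univ_four]
    ring
  have h'' := (mul_eq_zero.1 h').resolve_left hs.ne'
  have b1 : y 1 = y 0 := by linarith
  have b2 : y 2 = y 0 := by linarith
  have b3 : y 3 = y 0 := by linarith
  fin_cases k <;> simp [dot, alph, Fin.sum_univ_four, b1, b2, b3] <;> ring

/-- for every t ∈ [0,T], x ↦ u^T(t,x) is continuous on ℝ⁴. -/
theorem u_continuous_in_x (T : ℝ) (hT : 0 < T) (t : ℝ) (ht : t ∈ Set.Icc (0 : ℝ) T) :
    Continuous (fun x : Fin 4 → ℝ => u T t x) := by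
  have hI : Continuous fun x : Fin 4 → ℝ =>
      ∫ r : ℝ, Real.exp (-(T - t) * r ^ 2) * Lam r (sortv x) / r ^ 2 := by
    refine continuous_iff_continuousAt.2 fun x => ?_
    exact ContinuousAt.comp
      (g := fun y => ∫ r : ℝ, Real.exp (-(T - t) * r ^ 2) * Lam r y / r ^ 2) (f := sortv)
      (int_contAt (T - t) (by linarith [ht.2]) (sortv x) (mono_dot _ (sortv_mono x)))
      sortv_continuous.continuousAt
  unfold u
  fun_prop

end
end

section
/- Let x ∈ ℝ⁴ satisfy x₁ < x₂ < x₃ < x₄ (so that x^o = x). Then ∫_0^∞ Λ(r, x) r^{−2} dr = −4 α₄·x = −(4/√2)(3x₄ − x₁ − x₂ − x₃), where the integral converges absolutely. -/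
open MeasureTheory Finset

noncomputable section

def KK (d y : ℝ) : ℝ := (1 - Real.cos (d * y)) / y ^ 2

lemma KK_nonneg (d y : ℝ) : 0 ≤ KK d y :=
  div_nonneg (by linarith [Real.cos_le_one (d * y)]) (sq_nonneg y)

lemma KK_meas (d : ℝ) : Measurable (KK d) := by unfold KK; fun_prop

lemma KK_le (d y : ℝ) : KK d y ≤ (d ^ 2 / 2 + 2) * (1 + y ^ 2)⁻¹ := by
  unfold KK
  rcases eq_or_ne y 0 with rfl | hy
  · simp; positivity
  · have hy2 : 0 < y ^ 2 := by positivity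
    rw [← div_eq_mul_inv, div_le_div_iff₀ hy2 (by positivity)]
    have h1 := Real.one_sub_sq_div_two_le_cos (x := d * y)
    have h2 := Real.neg_one_le_cos (d * y)
    nlinarith

lemma KK_int (d : ℝ) : Integrable (KK d) := by
  refine (integrable_inv_one_add_sq.const_mul (d ^ 2 / 2 + 2)).mono' (KK_meas d).aestronglyMeasurable ?_
  filter_upwards with y
  rw [Real.norm_of_nonneg (KK_nonneg d y)]
  exact KK_le d y

lemma gam (y : ℝ) (hy : 0 < y) : ∫ t in Set.Ioi (0:ℝ), t * Real.exp (-(y * t)) = 1 / y ^ 2 := by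
  have := Real.integral_rpow_mul_exp_neg_mul_Ioi (a := 2) (r := y) (by norm_num) hy
  norm_num at this
  rw [this]; ring

lemma gam_int (y : ℝ) (hy : 0 < y) : IntegrableOn (fun t : ℝ => t * Real.exp (-(y * t))) (Set.Ioi 0) := by
  by_contra h
  have h1 := gam y hy
  rw [integral_undef h] at h1
  have : 0 < 1 / y ^ 2 := by positivity
  linarith

lemma lapcos (t : ℝ) (ht : 0 < t) :
    ∫ y in Set.Ioi (0:ℝ), Real.exp (-(y * t)) * (1 - Real.cos y) = 1 / (t * (1 + t ^ 2)) := by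
  have ha : (-(t : ℂ) + Complex.I).re < 0 := by simpa using ht
  have h1 := integral_exp_mul_complex_Ioi ha 0
  have i1 := integrableOn_exp_mul_complex_Ioi ha 0
  have hre : ∀ y : ℝ, (Complex.exp ((-(t : ℂ) + Complex.I) * y)).re = Real.exp (-(y * t)) * Real.cos y := by
    intro y
    rw [Complex.exp_re]; simp; left; ring
  have h2 : ∫ y in Set.Ioi (0:ℝ), Real.exp (-(y * t)) * Real.cos y = t / (1 + t ^ 2) := by
    have := integral_re i1
    simp only [RCLike.re_eq_complex_re, hre] at this
    rw [this, h1]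
    simp [Complex.div_re, Complex.normSq_apply]
    field_simp
    ring
  have i2 : IntegrableOn (fun y : ℝ => Real.exp (-(y * t)) * Real.cos y) (Set.Ioi 0) := by
    have := i1.re
    simp only [RCLike.re_eq_complex_re, hre] at this
    exact this
  have h3 := integral_exp_mul_Ioi (a := -t) (by linarith) 0
  have i3 := integrableOn_exp_mul_Ioi (a := -t) (by linarith) 0
  have e : ∀ y : ℝ, Real.exp (-t * y) = Real.exp (-(y * t)) := fun y => by congr 1; ring
  simp only [e] at h3 i3
  simp only [mul_sub, mul_one]
  rw [integral_sub i3 i2, h2, h3]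
  simp
  field_simp
  ring

lemma KK_half : ∫ y in Set.Ioi (0:ℝ), KK 1 y = Real.pi / 2 := by
  have e1 : ∀ y ∈ Set.Ioi (0:ℝ), ∫ t in Set.Ioi (0:ℝ), t * Real.exp (-(y * t)) * (1 - Real.cos y) = KK 1 y := by
    intro y hy
    rw [integral_mul_const, gam y hy, KK, one_mul]; ring
  have e2 : ∀ t ∈ Set.Ioi (0:ℝ), ∫ y in Set.Ioi (0:ℝ), t * Real.exp (-(y * t)) * (1 - Real.cos y) = (1 + t ^ 2)⁻¹ := by
    intro t ht
    have ht' : 0 < t := ht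
    simp only [mul_assoc]
    rw [integral_const_mul, lapcos t ht]
    field_simp
  rw [← setIntegral_congr_fun measurableSet_Ioi e1, integral_integral_swap,
    setIntegral_congr_fun measurableSet_Ioi e2, integral_Ioi_inv_one_add_sq]
  · simp
  · rw [integrable_prod_iff (Continuous.aestronglyMeasurable (by fun_prop))]
    constructor
    · filter_upwards [ae_restrict_mem measurableSet_Ioi] with y hy
      exact (gam_int y hy).mul_const (1 - Real.cos y)
    · refine Integrable.congr ((KK_int 1).integrableOn (s := Set.Ioi 0)) ?_
      filter_upwards [ae_restrict_mem measurableSet_Ioi] with y hy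
      rw [← e1 y hy]
      refine setIntegral_congr_fun measurableSet_Ioi ?_
      intro t ht
      have ht' : 0 < t := ht
      have := Real.cos_le_one y
      refine (Real.norm_of_nonneg ?_).symm
      exact mul_nonneg (by positivity) (by linarith)

lemma KK_even (d y : ℝ) : KK d |y| = KK d y := by
  unfold KK
  rcases abs_choice y with h | h <;> simp [h]

lemma KK_integral (d : ℝ) : ∫ y, KK d y = Real.pi * |d| := by
  have h1 : ∫ y, KK 1 y = Real.pi := by
    have := integral_comp_abs (f := KK 1)
    simp only [KK_even, KK_half] at this
    rw [this]; ring
  rcases eq_or_ne d 0 with rfl | hd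
  · simp [KK]
  have e : ∀ y, KK d y = d ^ 2 * KK 1 (d * y) := by
    intro y
    unfold KK
    rcases eq_or_ne y 0 with rfl | hy
    · simp
    · rw [one_mul]; field_simp
  simp only [e]
  rw [integral_const_mul, Measure.integral_comp_mul_left (fun y => KK 1 y), h1, smul_eq_mul, abs_inv, ← sq_abs]
  have : |d| ≠ 0 := abs_ne_zero.mpr hd
  field_simp

lemma KK_mul_cos (d m y : ℝ) : KK d y * Real.cos (m * y) =
    -KK m y + 1 / 2 * KK (m + d) y + 1 / 2 * KK (m - d) y := by
  unfold KK
  rw [add_mul, sub_mul, Real.cos_add, Real.cos_sub]; ring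

lemma KK_cos_integral (d m : ℝ) : ∫ y, KK d y * Real.cos (m * y) =
    Real.pi * (-|m| + 1 / 2 * |m + d| + 1 / 2 * |m - d|) := by
  simp only [KK_mul_cos]
  have i1 : Integrable (fun y => -KK m y) := (KK_int m).neg
  have i2 : Integrable (fun y => -KK m y + 1 / 2 * KK (m + d) y) := i1.add ((KK_int _).const_mul _)
  rw [integral_add i2 ((KK_int _).const_mul _),
    integral_add i1 ((KK_int _).const_mul _), integral_neg, integral_const_mul, integral_const_mul]
  simp only [KK_integral]; ring

lemma KK_sin_integral (d m : ℝ) : ∫ y, KK d y * Real.sin (m * y) = 0 := by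
  have h := integral_neg_eq_self (fun y => KK d y * Real.sin (m * y)) volume
  have e : ∀ y, KK d (-y) = KK d y := fun y => by simp [KK]
  simp only [e, mul_neg, Real.sin_neg, integral_neg] at h
  linarith

instance : Fact (0 < Real.pi) := ⟨Real.pi_pos⟩

lemma KK_fourier (d : ℝ) (h0 : 0 ≤ d) (h2 : d ≤ 2) (n : ℤ) :
    ∫ y : ℝ, (KK d y : ℂ) * fourier n (y : AddCircle Real.pi) = if n = 0 then (Real.pi * d : ℂ) else 0 := by
  have e : ∀ y : ℝ, (KK d y : ℂ) * fourier n (y : AddCircle Real.pi) =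
      ((KK d y * Real.cos ((2 * n : ℝ) * y) : ℝ) : ℂ) + ((KK d y * Real.sin ((2 * n : ℝ) * y) : ℝ) : ℂ) * Complex.I := by
    intro y
    rw [fourier_coe_apply, show 2 * (Real.pi : ℂ) * Complex.I * n * y / Real.pi = (((2 * n : ℝ) * y : ℝ) : ℂ) * Complex.I by
      have : (Real.pi : ℂ) ≠ 0 := by exact_mod_cast Real.pi_ne_zero
      push_cast; field_simp, Complex.exp_mul_I]
    push_cast; ring
  simp only [e]
  have ic : Integrable (fun y => KK d y * Real.cos ((2 * n : ℝ) * y)) :=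
    (KK_int d).mul_bdd (c := 1) (Continuous.aestronglyMeasurable (by fun_prop)) (by
      filter_upwards with y using Real.abs_cos_le_one _)
  have is : Integrable (fun y => KK d y * Real.sin ((2 * n : ℝ) * y)) :=
    (KK_int d).mul_bdd (c := 1) (Continuous.aestronglyMeasurable (by fun_prop)) (by
      filter_upwards with y using Real.abs_sin_le_one _)
  rw [integral_add ic.ofReal (is.ofReal.mul_const _), integral_mul_const, integral_complex_ofReal,
    integral_complex_ofReal, KK_sin_integral, KK_cos_integral]
  split_ifs with hn
  · subst hn; simp [abs_of_nonneg h0]; ring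
  · have : (-|(2 * n : ℝ)| + 1 / 2 * |(2 * n : ℝ) + d| + 1 / 2 * |(2 * n : ℝ) - d|) = 0 := by
      rcases lt_or_gt_of_ne hn with h | h
      · have : (n : ℝ) ≤ -1 := by exact_mod_cast (by omega : n ≤ -1)
        rw [abs_of_nonpos, abs_of_nonpos, abs_of_nonpos] <;> linarith
      · have : (1 : ℝ) ≤ n := by exact_mod_cast (by omega : 1 ≤ n)
        rw [abs_of_nonneg, abs_of_nonneg, abs_of_nonneg] <;> linarith
    rw [this]; simp

lemma KK_mul_int (d : ℝ) (f : C(AddCircle Real.pi, ℂ)) :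
    Integrable (fun y : ℝ => (KK d y : ℂ) * f (y : AddCircle Real.pi)) :=
  (KK_int d).ofReal.mul_bdd (c := ‖f‖) (Continuous.aestronglyMeasurable (by fun_prop)) (by
      filter_upwards with y using f.norm_coe_le_norm _)

def L1 (d : ℝ) : C(AddCircle Real.pi, ℂ) →L[ℂ] ℂ :=
  LinearMap.mkContinuous
    { toFun := fun f => ∫ y : ℝ, (KK d y : ℂ) * f (y : AddCircle Real.pi)
      map_add' := by
        intro f g
        simp only [ContinuousMap.add_apply, mul_add]
        exact integral_add (KK_mul_int d f) (KK_mul_int d g)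
      map_smul' := by
        intro c f
        simp only [ContinuousMap.smul_apply, smul_eq_mul, RingHom.id_apply, mul_left_comm _ c]
        exact integral_const_mul _ _ } (∫ y, KK d y) (by
    intro f
    simp only [LinearMap.coe_mk, AddHom.coe_mk]
    rw [← integral_mul_const]
    refine norm_integral_le_of_norm_le ((KK_int d).mul_const _) ?_
    filter_upwards with y
    rw [norm_mul, Complex.norm_real, Real.norm_of_nonneg (KK_nonneg d y)]
    exact mul_le_mul_of_nonneg_left (f.norm_coe_le_norm _) (KK_nonneg d y))

def L2 : C(AddCircle Real.pi, ℂ) →L[ℂ] ℂ :=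
  LinearMap.mkContinuous
    { toFun := fun f => ∫ y in (0:ℝ)..Real.pi, f (y : AddCircle Real.pi)
      map_add' := by
        intro f g
        simp only [ContinuousMap.add_apply]
        exact intervalIntegral.integral_add (Continuous.intervalIntegrable (by fun_prop) _ _)
          (Continuous.intervalIntegrable (by fun_prop) _ _)
      map_smul' := by
        intro c f
        simp only [ContinuousMap.smul_apply, smul_eq_mul, RingHom.id_apply]
        exact intervalIntegral.integral_const_mul _ _ } Real.pi (by
    intro f
    simp only [LinearMap.coe_mk, AddHom.coe_mk]
    have := intervalIntegral.norm_integral_le_of_norm_le_const (a := 0) (b := Real.pi) (C := ‖f‖)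
      (f := fun y : ℝ => f (y : AddCircle Real.pi)) (fun y _ => f.norm_coe_le_norm _)
    rw [sub_zero, abs_of_pos Real.pi_pos] at this
    linarith)

lemma L2_fourier (n : ℤ) : L2 (fourier n) = if n = 0 then (Real.pi : ℂ) else 0 := by
  change ∫ y in (0:ℝ)..Real.pi, fourier n (y : AddCircle Real.pi) = _
  split_ifs with hn
  · subst hn; simp
  · have e : ∀ y : ℝ, fourier n (y : AddCircle Real.pi) = Complex.exp ((2 * Complex.I * n) * y) := by
      intro y
      rw [fourier_coe_apply]
      congr 1
      have : (Real.pi : ℂ) ≠ 0 := by exact_mod_cast Real.pi_ne_zero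
      field_simp
    simp only [e]
    rw [integral_exp_mul_complex (by simp [hn])]
    rw [show 2 * Complex.I * n * (Real.pi : ℂ) = n * (2 * Real.pi * Complex.I) by ring,
      Complex.exp_int_mul_two_pi_mul_I]
    simp

lemma L_eq (d : ℝ) (h0 : 0 ≤ d) (h2 : d ≤ 2) : L1 d = (d : ℂ) • L2 := by
  refine ContinuousLinearMap.ext_on (s := Set.range (@fourier Real.pi)) ?_ ?_
  · rw [← Submodule.dense_iff_topologicalClosure_eq_top.symm.eq] 
    exact span_fourier_closure_eq_top
  · rintro _ ⟨n, rfl⟩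
    rw [smul_apply, L2_fourier]
    refine (KK_fourier d h0 h2 n).trans ?_
    split_ifs <;> simp [mul_comm]

lemma main_real (d : ℝ) (h0 : 0 ≤ d) (h2 : d ≤ 2) (F : ℝ → ℝ) (hc : Continuous F)
    (hp : Function.Periodic F Real.pi) :
    Integrable (fun y => KK d y * F y) ∧ ∫ y, KK d y * F y = d * ∫ y in (0:ℝ)..Real.pi, F y := by
  have hc' : Continuous (fun y => (F y : ℂ)) := by fun_prop
  have hp' : Function.Periodic (fun y => (F y : ℂ)) Real.pi := fun y => by simp [hp y]
  let f : C(AddCircle Real.pi, ℂ) := ⟨hp'.lift, continuous_coinduced_dom.mpr hc'⟩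
  have hf : ∀ y : ℝ, f (y : AddCircle Real.pi) = (F y : ℂ) := fun y => rfl
  constructor
  · have := (KK_mul_int d f).re
    simpa [hf] using this
  · have := congrArg (fun l => l f) (L_eq d h0 h2)
    change ∫ y : ℝ, (KK d y : ℂ) * f (y : AddCircle Real.pi) = (d:ℂ) * ∫ y in (0:ℝ)..Real.pi, f (y : AddCircle Real.pi) at this
    simp only [hf] at this
    rw [intervalIntegral.integral_ofReal] at this
    simp only [← Complex.ofReal_mul] at this
    rw [integral_complex_ofReal] at this
    exact_mod_cast this

lemma main_half (d : ℝ) (h0 : 0 ≤ d) (h2 : d ≤ 2) (F : ℝ → ℝ) (hc : Continuous F)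
    (hp : Function.Periodic F Real.pi) (he : ∀ y, F (-y) = F y) :
    IntegrableOn (fun y => KK d y * F y) (Set.Ioi 0) ∧
    ∫ y in Set.Ioi (0:ℝ), KK d y * F y = d / 2 * ∫ y in (0:ℝ)..Real.pi, F y := by
  obtain ⟨hi, h⟩ := main_real d h0 h2 F hc hp
  refine ⟨hi.integrableOn, ?_⟩
  have := integral_comp_abs (f := fun y => KK d y * F y)
  have e : ∀ y, F |y| = F y := fun y => by rcases abs_choice y with h | h <;> simp [h, he]
  simp only [KK_even, e, h] at this
  linarith

lemma int_abs_cos : ∫ y in (0:ℝ)..Real.pi, |Real.cos y| = 2 := by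
  have hp : Function.Periodic (fun y : ℝ => |Real.cos y|) Real.pi := fun y => by simp [Real.cos_add_pi]
  have h := hp.intervalIntegral_add_eq 0 (-(Real.pi / 2))
  rw [zero_add] at h
  rw [h, show -(Real.pi / 2) + Real.pi = Real.pi / 2 by ring]
  rw [intervalIntegral.integral_congr (g := Real.cos)]
  · rw [integral_cos]; simp; norm_num
  · intro y hy
    rw [Set.uIcc_of_le (by linarith [Real.pi_pos])] at hy
    exact abs_of_nonneg (Real.cos_nonneg_of_mem_Icc hy)

lemma int_abs_sin : ∫ y in (0:ℝ)..Real.pi, |Real.sin y| = 2 := by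
  rw [intervalIntegral.integral_congr (g := Real.sin)]
  · rw [integral_sin]; simp; norm_num
  · intro y hy
    rw [Set.uIcc_of_le (by linarith [Real.pi_pos])] at hy
    exact abs_of_nonneg (Real.sin_nonneg_of_mem_Icc hy)

lemma int_G : ∫ y in (0:ℝ)..Real.pi, (1 + |Real.cos y|)⁻¹ = 2 := by
  have hp : Function.Periodic (fun y : ℝ => (1 + |Real.cos y|)⁻¹) Real.pi := fun y => by simp [Real.cos_add_pi]
  have h := hp.intervalIntegral_add_eq 0 (-(Real.pi / 2))
  rw [zero_add] at h
  rw [h, show -(Real.pi / 2) + Real.pi = Real.pi / 2 by ring]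
  rw [intervalIntegral.integral_eq_sub_of_hasDerivAt (f := fun y => Real.tan (y / 2))]
  · rw [show -(Real.pi / 2) / 2 = -(Real.pi / 4) by ring, show Real.pi / 2 / 2 = Real.pi / 4 by ring]
    simp; norm_num
  · intro y hy
    rw [Set.uIcc_of_le (by linarith [Real.pi_pos])] at hy
    rw [abs_of_nonneg (Real.cos_nonneg_of_mem_Icc hy)]
    have hc : 0 < Real.cos (y / 2) := Real.cos_pos_of_mem_Ioo ⟨by linarith [hy.1, Real.pi_pos], by linarith [hy.2, Real.pi_pos]⟩
    have := (Real.hasDerivAt_tan hc.ne').comp y ((hasDerivAt_id y).div_const 2)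
    have h2 : Real.cos y = 2 * Real.cos (y / 2) ^ 2 - 1 := by rw [← Real.cos_two_mul]; ring_nf
    have h3 : 1 / Real.cos (y / 2) ^ 2 * (1 / 2) = (1 + Real.cos y)⁻¹ := by
      rw [h2, show 1 + (2 * Real.cos (y / 2) ^ 2 - 1) = 2 * Real.cos (y / 2) ^ 2 by ring]
      field_simp
    rw [h3] at this
    exact this
  · refine Continuous.intervalIntegrable ?_ _ _
    refine Continuous.inv₀ (by fun_prop) (fun y => by positivity)

lemma sign_mul_abs' (z : ℝ) : Real.sign z * z = |z| := by
  rcases lt_trichotomy z 0 with h | rfl | h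
  · simp [Real.sign_of_neg h, abs_of_neg h]
  · simp
  · simp [Real.sign_of_pos h, abs_of_pos h]

def Phi (δ ε y : ℝ) : ℝ :=
  2 * (|Real.cos y| + |Real.sin y|) * Real.cos (δ * y) +
    2 * (|Real.cos y| - |Real.sin y|) * Real.cos (ε * y) - 4

lemma Phi_integral (δ ε : ℝ) (h0 : 0 ≤ δ) (h2 : δ ≤ 2) (k0 : 0 ≤ ε) (k2 : ε ≤ 2) :
    IntegrableOn (fun y => Phi δ ε y / y ^ 2) (Set.Ioi 0) ∧
    ∫ y in Set.Ioi (0:ℝ), Phi δ ε y / y ^ 2 = -4 * δ - 4 := by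
  have ic : IntervalIntegrable (fun y : ℝ => |Real.cos y|) volume 0 Real.pi :=
    Continuous.intervalIntegrable (by fun_prop) _ _
  have is : IntervalIntegrable (fun y : ℝ => |Real.sin y|) volume 0 Real.pi :=
    Continuous.intervalIntegrable (by fun_prop) _ _
  obtain ⟨i1, e1⟩ := main_half δ h0 h2 (fun y => |Real.cos y| + |Real.sin y|) (by fun_prop)
    (fun y => by simp [Real.cos_add_pi, Real.sin_add_pi]) (fun y => by simp)
  obtain ⟨i2, e2⟩ := main_half ε k0 k2 (fun y => |Real.cos y| - |Real.sin y|) (by fun_prop)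
    (fun y => by simp [Real.cos_add_pi, Real.sin_add_pi]) (fun y => by simp)
  obtain ⟨i3, e3⟩ := main_half 2 (by norm_num) le_rfl (fun y => (1 + |Real.cos y|)⁻¹)
    (Continuous.inv₀ (by fun_prop) (fun y => by positivity))
    (fun y => by simp [Real.cos_add_pi]) (fun y => by simp)
  rw [intervalIntegral.integral_add ic is, int_abs_cos, int_abs_sin] at e1
  rw [intervalIntegral.integral_sub ic is, int_abs_cos, int_abs_sin] at e2
  rw [int_G] at e3
  have e : ∀ y, Phi δ ε y / y ^ 2 = (-2) * (KK δ y * (|Real.cos y| + |Real.sin y|)) +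
      (-2) * (KK ε y * (|Real.cos y| - |Real.sin y|)) + (-2) * (KK 2 y * (1 + |Real.cos y|)⁻¹) := by
    intro y
    have h3 : (1 - Real.cos (2 * y)) * (1 + |Real.cos y|)⁻¹ = 2 * (1 - |Real.cos y|) := by
      have : 1 + |Real.cos y| ≠ 0 := by positivity
      rw [Real.cos_two_mul, ← sq_abs (Real.cos y)]
      field_simp; ring
    have h4 : KK 2 y * (1 + |Real.cos y|)⁻¹ = 2 * (1 - |Real.cos y|) / y ^ 2 := by
      rw [← h3, KK]; ring
    rw [h4]
    unfold KK Phi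
    ring
  simp only [e]
  have j1 := i1.const_mul (-2)
  have j2 := i2.const_mul (-2)
  have j3 := i3.const_mul (-2)
  have j12 : IntegrableOn (fun y => (-2) * (KK δ y * (|Real.cos y| + |Real.sin y|)) +
      (-2) * (KK ε y * (|Real.cos y| - |Real.sin y|))) (Set.Ioi 0) := j1.add j2
  refine ⟨j12.add j3, ?_⟩
  rw [integral_add j12 j3, integral_add j1 j2, integral_const_mul, integral_const_mul,
    integral_const_mul, e1, e2, e3]
  ring

lemma Lam_eq (r c d e : ℝ) (x : Fin 4 → ℝ) (hc : dot theta x = -c)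
    (h0 : dot (alph 0) x = -c - e) (h1 : dot (alph 1) x = -c + e)
    (h2 : dot (alph 2) x = c - d) (h3 : dot (alph 3) x = c + d) (hc0 : 0 < c) :
    Lam r x = Phi (d / c) (e / c) (c * r) := by
  have hd : d / c * (c * r) = r * d := by field_simp
  have he : e / c * (c * r) = r * e := by field_simp
  unfold Lam Phi psi
  rw [hd, he, mul_comm c r, ← sign_mul_abs', ← sign_mul_abs', Real.sin_add_pi_div_two, hc]
  simp only [Fin.sum_univ_four, h0, h1, h2, h3, mul_add, mul_sub, mul_neg, Real.cos_neg, Real.sin_neg,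
    Real.sign_neg, Real.cos_add, Real.cos_sub, Real.sin_add, Real.sin_sub]
  ring

/-- for strictly sorted x, ∫_0^∞ Λ(r,x)/r² dr = −4 α₄·x
  = −(4/√2)(3x₄ − x₁ − x₂ − x₃), the integral converging absolutely. -/
theorem integral_Lam_eq (x : Fin 4 → ℝ)
    (h01 : x 0 < x 1) (h12 : x 1 < x 2) (h23 : x 2 < x 3) :
    IntegrableOn (fun r : ℝ => Lam r x / r ^ 2) (Set.Ioi 0) ∧
    (∫ r in Set.Ioi (0 : ℝ), Lam r x / r ^ 2) = -4 * dot (alph 3) x ∧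
    -4 * dot (alph 3) x = -(4 / Real.sqrt 2) * (3 * x 3 - x 0 - x 1 - x 2) := by
  have hs : 0 < 1 / Real.sqrt 2 := by positivity
  obtain ⟨s, hsd⟩ : ∃ s, s = 1 / Real.sqrt 2 := ⟨_, rfl⟩
  have hs3 : 3 / Real.sqrt 2 = 3 * s := by rw [hsd]; ring
  have hs4 : 4 / Real.sqrt 2 = 4 * s := by rw [hsd]; ring
  rw [← hsd] at hs
  obtain ⟨c, hc⟩ : ∃ c, c = s * (x 2 + x 3 - x 0 - x 1) := ⟨_, rfl⟩
  obtain ⟨d, hd⟩ : ∃ d, d = s * (2 * (x 3 - x 2)) := ⟨_, rfl⟩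
  obtain ⟨e, he⟩ : ∃ e, e = s * (2 * (x 1 - x 0)) := ⟨_, rfl⟩
  have hc0 : 0 < c := by rw [hc]; exact mul_pos hs (by linarith)
  have hd0 : 0 ≤ d := by rw [hd]; exact mul_nonneg hs.le (by linarith)
  have he0 : 0 ≤ e := by rw [he]; exact mul_nonneg hs.le (by linarith)
  have hd2 : d ≤ 2 * c := by rw [hd, hc]; nlinarith
  have he2 : e ≤ 2 * c := by rw [he, hc]; nlinarith
  have a0 : dot (alph 0) x = -c - e := by
    simp [dot, alph, Fin.sum_univ_four, hs3, ← one_div, ← hsd, hc, he]; ring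
  have a1 : dot (alph 1) x = -c + e := by
    simp [dot, alph, Fin.sum_univ_four, hs3, ← one_div, ← hsd, hc, he]; ring
  have a2 : dot (alph 2) x = c - d := by
    simp [dot, alph, Fin.sum_univ_four, hs3, ← one_div, ← hsd, hc, hd]; ring
  have a3 : dot (alph 3) x = c + d := by
    simp [dot, alph, Fin.sum_univ_four, hs3, ← one_div, ← hsd, hc, hd]; ring
  have ht : dot theta x = -c := by
    simp [dot, theta, Fin.sum_univ_four, ← one_div, ← hsd, hc]; ring
  obtain ⟨hi, hv⟩ := Phi_integral (d / c) (e / c) (by positivity) (by rw [div_le_iff₀ hc0]; exact hd2)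
    (by positivity) (by rw [div_le_iff₀ hc0]; exact he2)
  have hL : ∀ r, Lam r x / r ^ 2 = c ^ 2 * (Phi (d / c) (e / c) (c * r) / (c * r) ^ 2) := by
    intro r
    rw [Lam_eq r c d e x ht a0 a1 a2 a3 hc0]
    field_simp
  simp only [hL]
  refine ⟨?_, ?_, ?_⟩
  · have := (integrableOn_Ioi_comp_mul_left_iff (fun y => Phi (d / c) (e / c) y / y ^ 2) 0 hc0).mpr
      (by simpa using hi)
    exact this.const_mul (c ^ 2)
  · rw [integral_const_mul, integral_comp_mul_left_Ioi (fun y => Phi (d / c) (e / c) y / y ^ 2) 0 hc0,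
      mul_zero, hv, a3, smul_eq_mul]
    field_simp
    ring
  · rw [a3, hs4, hc, hd]; ring

end
end
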